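/- arXiv:2605.28426 — 3 statements merged into one kernel-verified Lean document; each statement's English description precedes it below -/
import Mathlib

section
/- Let $p \geq 1$ and for each $i \in \{1,\dots,p\}$ let $E_i$ be a nonempty complete metric space, and equip $X = \prod_{i=1}^p E_i$ with the sup metric $d(x,y) = \max_i d_i(x_i, y_i)$. Let $G : X \to X$ be a contraction with constant $\rho \in [0,1)$, i.e. $d(G(x), G(y)) \leq \rho\, d(x,y)$ for all $x, y$, and let $x^*$ be its unique fixed point. Let $(x^{(k)})_{k \geq 0}$ be an asynchronous iteration: there are update sets $I_k \subseteq \{1,\dots,p\}$ and delay functions $s_k : \{1,\dots,p\} \to \mathbb{N}$ with $s_k(j) \leq k$, such that for every $k$ and every block $i$, $x^{(k+1)}_i = G_i\bigl(x^{(s_k(1))}_1, \dots, x^{(s_k(p))}_p\bigr)$ if $i \in I_k$ and $x^{(k+1)}_i = x^{(k)}_i$ otherwise. Assume bounded delay: there is $\tau \in \mathbb{N}$ with $k - s_k(j) \leq \tau$ for all $k, j$; and assume each block index $i$ belongs to $I_k$ for infinitely many $k$. Then $x^{(k)} \to x^*$ as $k \to \infty$. -/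
/-- If `G` is `ρ`-Lipschitz with fixed point `xstar` and a delayed snapshot is within `C` of
`xstar`, then so is, up to the factor `ρ`, every block updated from that snapshot. -/
theorem dist_update_le {ι : Type*} [Fintype ι] {E : ι → Type*} [∀ i, MetricSpace (E i)]
    {G : (∀ i, E i) → (∀ i, E i)} {ρ : ℝ} (hρ0 : 0 ≤ ρ)
    (hG : ∀ x y : ∀ i, E i, dist (G x) (G y) ≤ ρ * dist x y)
    {xstar : ∀ i, E i} (hfix : G xstar = xstar) {y : ∀ i, E i} {C : ℝ} (hC : 0 ≤ C)
    (hy : ∀ j, dist (y j) (xstar j) ≤ C) (i : ι) :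
    dist (G y i) (xstar i) ≤ ρ * C :=
  calc dist (G y i) (xstar i) = dist (G y i) (G xstar i) := by rw [hfix]
    _ ≤ dist (G y) (G xstar) := dist_le_pi_dist _ _ i
    _ ≤ ρ * dist y xstar := hG _ _
    _ ≤ ρ * C := mul_le_mul_of_nonneg_left ((dist_pi_le_iff hC).2 hy) hρ0

open Filter in
/-- An eventual error bound for an asynchronous iteration with bounded delay eventually improves
by the contraction factor. -/
theorem eventually_dist_le_mul {ι : Type*} [Fintype ι] {E : ι → Type*} [∀ i, MetricSpace (E i)]
    {G : (∀ i, E i) → (∀ i, E i)} {ρ : ℝ} (hρ0 : 0 ≤ ρ)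
    (hG : ∀ x y : ∀ i, E i, dist (G x) (G y) ≤ ρ * dist x y)
    {xstar : ∀ i, E i} (hfix : G xstar = xstar) {x : ℕ → ∀ i, E i}
    {I : ℕ → Set ι} {s : ℕ → ι → ℕ}
    (hupd : ∀ k, ∀ i ∈ I k, x (k + 1) i = G (fun j => x (s k j) j) i)
    (hkeep : ∀ k, ∀ i, i ∉ I k → x (k + 1) i = x k i)
    {τ : ℕ} (hτ : ∀ k j, k - s k j ≤ τ)
    (hinf : ∀ i, ∀ N : ℕ, ∃ k, N ≤ k ∧ i ∈ I k) {C : ℝ} (hC : 0 ≤ C)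
    (h : ∀ᶠ k in atTop, dist (x k) xstar ≤ C) :
    ∀ᶠ k in atTop, dist (x k) xstar ≤ ρ * C := by
  obtain ⟨N, hN⟩ := eventually_atTop.1 h
  have updated : ∀ k, N + τ ≤ k → ∀ i ∈ I k, dist (x (k + 1) i) (xstar i) ≤ ρ * C := by
    intro k hk i hi
    rw [hupd k i hi]
    refine dist_update_le hρ0 hG hfix hC (fun j => ?_) i
    exact (dist_le_pi_dist _ _ j).trans (hN _ (by have := hτ k j; omega))
  simp only [dist_pi_le_iff (mul_nonneg hρ0 hC)]
  refine eventually_all.2 fun i => ?_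
  obtain ⟨m, hm, hi⟩ := hinf i (N + τ)
  refine eventually_atTop.2 ⟨m + 1, fun k hk => ?_⟩
  induction k, hk using Nat.le_induction with
  | base => exact updated m hm i hi
  | succ k hk ih =>
    by_cases hik : i ∈ I k
    · exact updated k (by omega) i hik
    · rwa [hkeep k i hik]

/-- An asynchronous iteration of a contraction stays within its initial distance of the fixed
point. -/
theorem dist_le_dist_zero {ι : Type*} [Fintype ι] {E : ι → Type*} [∀ i, MetricSpace (E i)]
    {G : (∀ i, E i) → (∀ i, E i)} {ρ : ℝ} (hρ0 : 0 ≤ ρ) (hρ1 : ρ ≤ 1)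
    (hG : ∀ x y : ∀ i, E i, dist (G x) (G y) ≤ ρ * dist x y)
    {xstar : ∀ i, E i} (hfix : G xstar = xstar) {x : ℕ → ∀ i, E i}
    {I : ℕ → Set ι} {s : ℕ → ι → ℕ} (hs : ∀ k j, s k j ≤ k)
    (hupd : ∀ k, ∀ i ∈ I k, x (k + 1) i = G (fun j => x (s k j) j) i)
    (hkeep : ∀ k, ∀ i, i ∉ I k → x (k + 1) i = x k i) (k : ℕ) :
    dist (x k) xstar ≤ dist (x 0) xstar := by
  induction k using Nat.strong_induction_on with
  | _ k ih =>
    cases k with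
    | zero => exact le_rfl
    | succ k =>
      refine (dist_pi_le_iff dist_nonneg).2 fun i => ?_
      by_cases hik : i ∈ I k
      · rw [hupd k i hik]
        refine (dist_update_le hρ0 hG hfix dist_nonneg (fun j => ?_) i).trans
          (mul_le_of_le_one_left dist_nonneg hρ1)
        exact (dist_le_pi_dist _ _ j).trans (ih _ (Nat.lt_succ_of_le (hs k j)))
      · rw [hkeep k i hik]
        exact (dist_le_pi_dist _ _ i).trans (ih k k.lt_succ_self)

/-- Frommer–Szyld asynchronous iteration convergence: if `G` is a `ρ`-contraction
(`ρ < 1`) on the product of complete metric spaces equipped with the sup metric,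
the asynchronous iteration with bounded delay `τ` in which every block is updated
infinitely often converges to the unique fixed point `xstar`. -/
theorem async_fixed_point_convergence
    {p : ℕ} (hp : 1 ≤ p)
    (E : Fin p → Type*) [∀ i, MetricSpace (E i)]
    [∀ i, Nonempty (E i)] [∀ i, CompleteSpace (E i)]
    (G : (∀ i, E i) → (∀ i, E i))
    (ρ : ℝ) (hρ0 : 0 ≤ ρ) (hρ1 : ρ < 1)
    (hG : ∀ x y : ∀ i, E i, dist (G x) (G y) ≤ ρ * dist x y)
    (xstar : ∀ i, E i) (hfix : G xstar = xstar)
    (x : ℕ → ∀ i, E i)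
    (I : ℕ → Set (Fin p)) (s : ℕ → Fin p → ℕ)
    (hs : ∀ k j, s k j ≤ k)
    (hupd : ∀ k, ∀ i ∈ I k, x (k + 1) i = G (fun j => x (s k j) j) i)
    (hkeep : ∀ k, ∀ i, i ∉ I k → x (k + 1) i = x k i)
    (τ : ℕ) (hτ : ∀ k j, k - s k j ≤ τ)
    (hinf : ∀ i : Fin p, ∀ N : ℕ, ∃ k, N ≤ k ∧ i ∈ I k) :
    Filter.Tendsto x Filter.atTop (nhds xstar) := by
  have bound : ∀ n : ℕ, ∀ᶠ k in Filter.atTop, dist (x k) xstar ≤ ρ ^ n * dist (x 0) xstar := by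
    intro n
    induction n with
    | zero =>
      refine Filter.Eventually.of_forall fun k => ?_
      simpa using dist_le_dist_zero hρ0 hρ1.le hG hfix hs hupd hkeep k
    | succ n ih =>
      rw [pow_succ', mul_assoc]
      exact eventually_dist_le_mul hρ0 hG hfix hupd hkeep hτ hinf (by positivity) ih
  have lim : Filter.Tendsto (fun n : ℕ => ρ ^ n * dist (x 0) xstar) Filter.atTop (nhds 0) := by
    simpa using (tendsto_pow_atTop_nhds_zero_of_lt_one hρ0 hρ1).mul_const (dist (x 0) xstar)
  refine Metric.tendsto_nhds.2 fun ε hε => ?_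
  obtain ⟨n, hn⟩ := (lim.eventually (gt_mem_nhds hε)).exists
  exact (bound n).mono fun k hk => hk.trans_lt hn
end

section
/- Let $p \geq 1$, let $E_1, \dots, E_p$ be nonempty complete metric spaces, equip $X = \prod_i E_i$ with the sup metric, and let $G : X \to X$ be a contraction with constant $\rho \in [0,1)$ and fixed point $x^*$. Let $(x^{(k)})$ be an asynchronous iteration as in the Frommer–Szyld model with delay bound $\tau$, started from $x^{(0)}$ (with all historical values before step $0$ equal to $x^{(0)}$). Assume in addition a window condition: there is $B \geq 1$ such that for every $k$, each block index $i$ is updated at least once among steps $k, k+1, \dots, k+B-1$. Then for all $k$, $d(x^{(k)}, x^*) \leq \rho^{\lfloor k/(B+\tau+1) \rfloor}\, d(x^{(0)}, x^*)$; in particular the asynchronous iteration converges geometrically, possibly at a slower rate than the synchronous rate $\rho^k$. -/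
/-- One application of a contraction shrinks every block-wise error bound by the factor `ρ`. -/
theorem dist_apply_fixed_le_mul {ι : Type*} [Fintype ι] {E : ι → Type*}
    [∀ i, PseudoMetricSpace (E i)] {G : (∀ i, E i) → (∀ i, E i)} {ρ : ℝ} (hρ0 : 0 ≤ ρ)
    (hG : ∀ x y : ∀ i, E i, dist (G x) (G y) ≤ ρ * dist x y)
    {z : ∀ i, E i} (hfix : G z = z) {y : ∀ i, E i} {c : ℝ} (hc : 0 ≤ c)
    (hy : ∀ j, dist (y j) (z j) ≤ c) (i : ι) : dist (G y i) (z i) ≤ ρ * c :=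
  calc dist (G y i) (z i) = dist (G y i) (G z i) := by rw [hfix]
    _ ≤ dist (G y) (G z) := dist_le_pi_dist _ _ i
    _ ≤ ρ * dist y z := hG y z
    _ ≤ ρ * c := mul_le_mul_of_nonneg_left ((dist_pi_le_iff hc).2 hy) hρ0


/-- Geometric convergence rate of the Frommer–Szyld asynchronous iteration under the
bounded delay assumption (delay bound `τ`) and the window condition (every block is
updated at least once in every window of `B` consecutive steps):
`d(x⁽ᵏ⁾, x*) ≤ ρ ^ ⌊k / (B + τ + 1)⌋ * d(x⁽⁰⁾, x*)`. -/
theorem async_fixed_point_geometric_rate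
    {p : ℕ} (hp : 1 ≤ p)
    (E : Fin p → Type*) [∀ i, MetricSpace (E i)]
    [∀ i, Nonempty (E i)] [∀ i, CompleteSpace (E i)]
    (G : (∀ i, E i) → (∀ i, E i))
    (ρ : ℝ) (hρ0 : 0 ≤ ρ) (hρ1 : ρ < 1)
    (hG : ∀ x y : ∀ i, E i, dist (G x) (G y) ≤ ρ * dist x y)
    (xstar : ∀ i, E i) (hfix : G xstar = xstar)
    (x : ℕ → ∀ i, E i)
    (I : ℕ → Set (Fin p)) (s : ℕ → Fin p → ℕ)
    (hs : ∀ k j, s k j ≤ k)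
    (hupd : ∀ k, ∀ i ∈ I k, x (k + 1) i = G (fun j => x (s k j) j) i)
    (hkeep : ∀ k, ∀ i, i ∉ I k → x (k + 1) i = x k i)
    (τ : ℕ) (hτ : ∀ k j, k - s k j ≤ τ)
    (B : ℕ) (hB : 1 ≤ B)
    (hwin : ∀ k : ℕ, ∀ i : Fin p, ∃ m, k ≤ m ∧ m < k + B ∧ i ∈ I m) :
    ∀ k : ℕ, dist (x k) xstar ≤ ρ ^ (k / (B + τ + 1)) * dist (x 0) xstar := by
  have hd : 0 ≤ dist (x 0) xstar := dist_nonneg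
  have hbound : ∀ k i, dist (x k i) (xstar i) ≤ dist (x 0) xstar := by
    intro k
    induction k using Nat.strong_induction_on with
    | _ k ih =>
      intro i
      cases k with
      | zero => exact dist_le_pi_dist _ _ i
      | succ k =>
        by_cases hi : i ∈ I k
        · rw [hupd k i hi]
          exact (dist_apply_fixed_le_mul hρ0 hG hfix hd
            (fun j => ih _ (Nat.lt_succ_of_le (hs k j)) j) i).trans
              (mul_le_of_le_one_left hd hρ1.le)
        · rw [hkeep k i hi]
          exact ih k k.lt_succ_self i
  -- Once all blocks are within `c` from step `K` on, an update from step `K + τ` on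
  -- brings its block within `ρ * c`, and the block stays there.
  have hcontract : ∀ (K : ℕ) (c : ℝ), 0 ≤ c →
      (∀ k, K ≤ k → ∀ i, dist (x k i) (xstar i) ≤ c) →
      ∀ i m, K + τ ≤ m → i ∈ I m → ∀ k, m + 1 ≤ k → dist (x k i) (xstar i) ≤ ρ * c := by
    intro K c hc hK i m hm him k hk
    have hstep : ∀ l, m ≤ l → i ∈ I l → dist (x (l + 1) i) (xstar i) ≤ ρ * c := by
      intro l hl hi
      rw [hupd l i hi]
      refine dist_apply_fixed_le_mul hρ0 hG hfix hc (fun j => hK _ ?_ j) i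
      have := hτ l j
      omega
    induction k, hk using Nat.le_induction with
    | base => exact hstep m le_rfl him
    | succ k hk ih =>
      by_cases hi : i ∈ I k
      · exact hstep k (by omega) hi
      · rwa [hkeep k i hi]
  have hgeom : ∀ n k, n * (B + τ + 1) ≤ k →
      ∀ i, dist (x k i) (xstar i) ≤ ρ ^ n * dist (x 0) xstar := by
    intro n
    induction n with
    | zero => simpa using hbound
    | succ n ih =>
      intro k hk i
      obtain ⟨m, hm, hmB, him⟩ := hwin (n * (B + τ + 1) + τ) i
      rw [Nat.succ_mul] at hk
      rw [pow_succ', mul_assoc]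
      exact hcontract _ _ (by positivity) ih i m hm him k (by omega)
  intro k
  exact (dist_pi_le_iff (by positivity)).2 (hgeom _ k (Nat.div_mul_le_self k _))
end

section
/- Let $\mathcal{S}$, $\mathcal{A}$, $P$, $R$, $\gamma \in [0,1)$ define a finite MDP with Bellman optimality operator $T$ and optimal value function $V^*$ (the unique fixed point of $T$). Let $(V^{(k)})_{k \geq 0}$ be an asynchronous value iteration: at each step $k$, a subset $\mathcal{S}_k \subseteq \mathcal{S}$ of states is updated via $V^{(k+1)}(s) = \max_a \bigl[R(s,a) + \gamma \sum_{s'} P(s'|s,a)\, V^{(s^k_{s'})}(s')\bigr]$ for $s \in \mathcal{S}_k$, where each read index satisfies $s^k_{s'} \leq k$, while $V^{(k+1)}(s) = V^{(k)}(s)$ for $s \notin \mathcal{S}_k$. Assume bounded delay $k - s^k_{s'} \leq \tau$ for a fixed $\tau$, and assume every state is updated at infinitely many steps. Then $V^{(k)} \to V^*$ as $k \to \infty$. -/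
open scoped BigOperators

lemma abs_iSup_sub_iSup_le {ι : Type*} [Finite ι] [Nonempty ι] {f g : ι → ℝ} {c : ℝ}
    (h : ∀ i, |f i - g i| ≤ c) : |(⨆ i, f i) - ⨆ i, g i| ≤ c := by
  rw [abs_sub_le_iff, sub_le_iff_le_add, sub_le_iff_le_add]
  constructor
  · exact ciSup_le fun i => by
      linarith [(abs_le.mp (h i)).2, le_ciSup (Set.finite_range g).bddAbove i]
  · exact ciSup_le fun i => by
      linarith [(abs_le.mp (h i)).1, le_ciSup (Set.finite_range f).bddAbove i]

/-- The Bellman optimality operator is a `γ`-contraction in the supremum norm. -/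
lemma abs_bellman_sub_bellman_le {S A : Type*} [Fintype S] [Finite A] [Nonempty A]
    {p : A → S → ℝ} (hp0 : ∀ a s', 0 ≤ p a s') (hp1 : ∀ a, ∑ s', p a s' = 1)
    (r : A → ℝ) {γ : ℝ} (hγ0 : 0 ≤ γ) {v w : S → ℝ} {c : ℝ} (h : ∀ s', |v s' - w s'| ≤ c) :
    |(⨆ a, (r a + γ * ∑ s', p a s' * v s')) - ⨆ a, (r a + γ * ∑ s', p a s' * w s')|
      ≤ γ * c := by
  refine abs_iSup_sub_iSup_le fun a => ?_
  rw [add_sub_add_left_eq_sub, ← mul_sub, abs_mul, abs_of_nonneg hγ0, ← Finset.sum_sub_distrib]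
  refine mul_le_mul_of_nonneg_left ?_ hγ0
  calc |∑ s', (p a s' * v s' - p a s' * w s')|
      ≤ ∑ s', |p a s' * v s' - p a s' * w s'| := Finset.abs_sum_le_sum_abs _ _
    _ ≤ ∑ s', p a s' * c := Finset.sum_le_sum fun s' _ => by
        rw [← mul_sub, abs_mul, abs_of_nonneg (hp0 a s')]
        exact mul_le_mul_of_nonneg_left (h s') (hp0 a s')
    _ = c := by rw [← Finset.sum_mul, hp1, one_mul]

/-- Errors of an asynchronous iteration with bounded delay tend to zero if every update
contracts the supremum of the errors it reads by a factor `γ < 1`. -/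
lemma tendsto_zero_of_async_contraction {S : Type*} [Fintype S] {e : ℕ → S → ℝ}
    (he : ∀ k s, 0 ≤ e k s) {γ : ℝ} (hγ0 : 0 ≤ γ) (hγ1 : γ < 1)
    {U : ℕ → Set S} {σ : ℕ → S → ℕ} (hσ : ∀ k s', σ k s' ≤ k)
    (hupd : ∀ k, ∀ s ∈ U k, ∀ c, (∀ s', e (σ k s') s' ≤ c) → e (k + 1) s ≤ γ * c)
    (hkeep : ∀ k, ∀ s, s ∉ U k → e (k + 1) s = e k s)
    {τ : ℕ} (hτ : ∀ k s', k - σ k s' ≤ τ)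
    (hinf : ∀ s, ∀ N : ℕ, ∃ k, N ≤ k ∧ s ∈ U k) (s : S) :
    Filter.Tendsto (fun k => e k s) Filter.atTop (nhds 0) := by
  set c := ∑ s, e 0 s
  have hc : 0 ≤ c := Finset.sum_nonneg fun s _ => he 0 s
  have bound : ∀ k s, e k s ≤ c := by
    intro k
    induction k using Nat.strong_induction_on with
    | _ k ih =>
      intro s
      rcases k with _ | k
      · exact Finset.single_le_sum (fun s _ => he 0 s) (Finset.mem_univ s)
      · by_cases hs : s ∈ U k
        · exact (hupd k s hs c fun s' => ih _ (Nat.lt_succ_of_le (hσ k s')) s').trans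
            (mul_le_of_le_one_left hc hγ1.le)
        · rw [hkeep k s hs]
          exact ih k k.lt_succ_self s
  have decay : ∀ n : ℕ, ∃ N, ∀ k, N ≤ k → ∀ s, e k s ≤ γ ^ n * c := by
    intro n
    induction n with
    | zero => exact ⟨0, fun k _ s => by simpa using bound k s⟩
    | succ n ih =>
      obtain ⟨N, hN⟩ := ih
      have step : ∀ k, N + τ ≤ k → ∀ s ∈ U k, e (k + 1) s ≤ γ ^ (n + 1) * c := by
        intro k hk s hs
        rw [pow_succ', mul_assoc]
        exact hupd k s hs _ fun s' => hN _ (by have := hτ k s'; omega) s'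
      choose K hK hKU using fun s => hinf s (N + τ)
      refine ⟨Finset.univ.sup K + 1, fun k hk s => ?_⟩
      replace hk : K s + 1 ≤ k :=
        (Nat.succ_le_succ (Finset.le_sup (f := K) (Finset.mem_univ s))).trans hk
      induction k, hk using Nat.le_induction with
      | base => exact step _ (hK s) s (hKU s)
      | succ k hk ih =>
        by_cases hs : s ∈ U k
        · exact step k (by have := hK s; omega) s hs
        · rwa [hkeep k s hs]
  have hlim : Filter.Tendsto (fun n => γ ^ n * c) Filter.atTop (nhds 0) := by
    simpa using (tendsto_pow_atTop_nhds_zero_of_lt_one hγ0 hγ1).mul_const c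
  rw [Metric.tendsto_atTop]
  intro ε hε
  obtain ⟨n, hn⟩ := (hlim.eventually (gt_mem_nhds hε)).exists
  obtain ⟨N, hN⟩ := decay n
  refine ⟨N, fun k hk => ?_⟩
  rw [Real.dist_0_eq_abs, abs_of_nonneg (he k s)]
  exact (hN k hk s).trans_lt hn

/-- Asynchronous value iteration for a finite MDP (Bertsekas–Tsitsiklis): updated states
may read stale values of other states; under the bounded delay assumption
(`k - σ k s' ≤ τ`) and the assumption that every state is updated infinitely often,
the iterates converge to the optimal value function `V*` (the fixed point of the
Bellman optimality operator). -/
theorem async_value_iteration_convergence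
    {S A : Type*} [Fintype S] [Fintype A] [Nonempty S] [Nonempty A]
    (P : S → A → S → ℝ)
    (hP0 : ∀ s a s', 0 ≤ P s a s')
    (hP1 : ∀ s a, ∑ s', P s a s' = 1)
    (R : S → A → ℝ)
    (γ : ℝ) (hγ0 : 0 ≤ γ) (hγ1 : γ < 1)
    (Vstar : S → ℝ)
    (hfix : ∀ s, Vstar s = ⨆ a : A, (R s a + γ * ∑ s', P s a s' * Vstar s'))
    (V : ℕ → S → ℝ)
    (Sk : ℕ → Set S) (σ : ℕ → S → ℕ)
    (hσ : ∀ k s', σ k s' ≤ k)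
    (hupd : ∀ k, ∀ s ∈ Sk k,
      V (k + 1) s = ⨆ a : A, (R s a + γ * ∑ s', P s a s' * V (σ k s') s'))
    (hkeep : ∀ k, ∀ s, s ∉ Sk k → V (k + 1) s = V k s)
    (τ : ℕ) (hτ : ∀ k s', k - σ k s' ≤ τ)
    (hinf : ∀ s : S, ∀ N : ℕ, ∃ k, N ≤ k ∧ s ∈ Sk k) :
    Filter.Tendsto V Filter.atTop (nhds Vstar) := by
  rw [tendsto_pi_nhds]
  intro s
  rw [tendsto_iff_dist_tendsto_zero]
  refine tendsto_zero_of_async_contraction (e := fun k s => dist (V k s) (Vstar s))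
    (fun _ _ => dist_nonneg) hγ0 hγ1 hσ (fun k s hs c hc => ?_)
    (fun k s hs => by simp only [hkeep k s hs]) hτ hinf s
  rw [Real.dist_eq, hupd k s hs, hfix s]
  exact abs_bellman_sub_bellman_le (hP0 s) (hP1 s) (R s) hγ0 hc
end
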